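/- The relativisation map is a unital *-homomorphism for projection-valued references: Let G be a finite group, g ↦ U_S(g) a unitary representation of G on H_S, and (Q_g)_{g∈G} a family of pairwise orthogonal orthogonal projections on H_R with Σ_{g∈G} Q_g = 1. Then the relativisation map ¥ satisfies: ¥(1) = 1; ¥(A^*) = ¥(A)^* for every operator A on H_S; and ¥(A∘B) = ¥(A)∘¥(B) for all operators A, B on H_S. -/

import Mathlib

open scoped InnerProductSpace
open ContinuousLinearMap

noncomputable section

/-- An abstract tensor product structure realising the Hilbert space `H` as the tensor
product of the Hilbert spaces `E` and `F`, with the induced inner product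
`⟪x⊗y, x'⊗y'⟫ = ⟪x,x'⟫⟪y,y'⟫`, and with the induced action `tmap B C = B ⊗ C` of pairs
of operators. -/
structure TensorStruct (E F H : Type*)
    [NormedAddCommGroup E] [InnerProductSpace ℂ E]
    [NormedAddCommGroup F] [InnerProductSpace ℂ F]
    [NormedAddCommGroup H] [InnerProductSpace ℂ H] where
  tmul : E →ₗ[ℂ] F →ₗ[ℂ] H
  inner_tmul : ∀ (x x' : E) (y y' : F),
    ⟪tmul x y, tmul x' y'⟫_ℂ = ⟪x, x'⟫_ℂ * ⟪y, y'⟫_ℂ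
  span_tmul : Submodule.span ℂ {z : H | ∃ x y, z = tmul x y} = ⊤
  tmap : (E →L[ℂ] E) → (F →L[ℂ] F) → (H →L[ℂ] H)
  tmap_tmul : ∀ (B : E →L[ℂ] E) (C : F →L[ℂ] F) (x : E) (y : F),
    tmap B C (tmul x y) = tmul (B x) (C y)

/-- The relativisation map `¥`, sending an operator `A` on `H_S` to the operator
`¥(A) = ∑ g, (U_S(g) A U_S(g)^*) ⊗ Q_g` on `H_S⊗H_R`. -/
def yen {HS HR H : Type*}
    [NormedAddCommGroup HS] [InnerProductSpace ℂ HS] [FiniteDimensional ℂ HS]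
    [NormedAddCommGroup HR] [InnerProductSpace ℂ HR] [FiniteDimensional ℂ HR]
    [NormedAddCommGroup H] [InnerProductSpace ℂ H] [FiniteDimensional ℂ H]
    (T : TensorStruct HS HR H)
    {G : Type*} [Group G] [Fintype G]
    (US : G → (HS →L[ℂ] HS)) (Q : G → (HR →L[ℂ] HR))
    (A : HS →L[ℂ] HS) : H →L[ℂ] H :=
  ∑ g : G, T.tmap (US g * A * adjoint (US g)) (Q g)

namespace TensorStruct

variable {E F H : Type*}
  [NormedAddCommGroup E] [InnerProductSpace ℂ E]
  [NormedAddCommGroup F] [InnerProductSpace ℂ F]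
  [NormedAddCommGroup H] [InnerProductSpace ℂ H]

theorem clm_ext (T : TensorStruct E F H) {S S' : H →L[ℂ] H}
    (h : ∀ x y, S (T.tmul x y) = S' (T.tmul x y)) : S = S' := by
  have hlin : (S : H →ₗ[ℂ] H) = S' := by
    refine LinearMap.ext_on T.span_tmul ?_
    rintro _ ⟨x, y, rfl⟩
    exact h x y
  exact ContinuousLinearMap.coe_injective hlin

theorem ext_inner_tmul (T : TensorStruct E F H) {u v : H}
    (h : ∀ x y, ⟪T.tmul x y, u⟫_ℂ = ⟪T.tmul x y, v⟫_ℂ) : u = v := by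
  have hlin : (innerSL ℂ u : H →ₗ[ℂ] ℂ) = innerSL ℂ v := by
    refine LinearMap.ext_on T.span_tmul ?_
    rintro _ ⟨x, y, rfl⟩
    simpa using congrArg (starRingEnd ℂ) (h x y)
  exact ext_inner_right ℂ fun w => LinearMap.congr_fun hlin w

theorem tmap_mul_tmap (T : TensorStruct E F H) (B B' : E →L[ℂ] E) (C C' : F →L[ℂ] F) :
    T.tmap B C * T.tmap B' C' = T.tmap (B * B') (C * C') :=
  T.clm_ext fun x y => by simp [T.tmap_tmul]

theorem tmap_zero_right (T : TensorStruct E F H) (B : E →L[ℂ] E) : T.tmap B 0 = 0 :=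
  T.clm_ext fun x y => by simp [T.tmap_tmul]

theorem sum_tmap_one {ι : Type*} (T : TensorStruct E F H) (s : Finset ι)
    (Q : ι → (F →L[ℂ] F)) (hQ : ∑ i ∈ s, Q i = 1) : ∑ i ∈ s, T.tmap 1 (Q i) = 1 :=
  T.clm_ext fun x y => by
    simp only [sum_apply, T.tmap_tmul, ← map_sum]
    rw [← sum_apply, hQ]
    simp

theorem adjoint_tmap [CompleteSpace E] [CompleteSpace F] [CompleteSpace H]
    (T : TensorStruct E F H) (B : E →L[ℂ] E) (C : F →L[ℂ] F) :
    adjoint (T.tmap B C) = T.tmap (adjoint B) (adjoint C) :=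
  T.clm_ext fun x y => T.ext_inner_tmul fun x' y' => by
    simp only [adjoint_inner_right, T.tmap_tmul, T.inner_tmul]

end TensorStruct

/-- **The relativisation map is a unital *-homomorphism for projection-valued
references.** For a unitary representation `U_S` of a finite group `G` and a family
`(Q_g)` of pairwise orthogonal orthogonal projections on `H_R` summing to `1`:
`¥(1) = 1`, `¥(A^*) = ¥(A)^*`, and `¥(A∘B) = ¥(A)∘¥(B)`. -/
theorem yen_star_hom
    {HS HR H : Type*}
    [NormedAddCommGroup HS] [InnerProductSpace ℂ HS] [FiniteDimensional ℂ HS]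
    [NormedAddCommGroup HR] [InnerProductSpace ℂ HR] [FiniteDimensional ℂ HR]
    [NormedAddCommGroup H] [InnerProductSpace ℂ H] [FiniteDimensional ℂ H]
    (T : TensorStruct HS HR H)
    {G : Type*} [Group G] [Fintype G]
    -- `U_S` is a unitary representation of `G` on `H_S`
    (US : G → (HS →L[ℂ] HS))
    (hUS1 : US 1 = 1)
    (hUSmul : ∀ g h : G, US (g * h) = US g * US h)
    (hUSuni : ∀ g : G, adjoint (US g) * US g = 1 ∧ US g * adjoint (US g) = 1)
    -- `(Q_g)` is a family of pairwise orthogonal orthogonal projections summing to `1`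
    (Q : G → (HR →L[ℂ] HR))
    (hQsa : ∀ g, adjoint (Q g) = Q g)
    (hQidem : ∀ g, Q g * Q g = Q g)
    (hQorth : ∀ g h : G, g ≠ h → Q g * Q h = 0)
    (hQsum : ∑ g : G, Q g = 1) :
    yen T US Q 1 = 1
    ∧ (∀ A : HS →L[ℂ] HS, yen T US Q (adjoint A) = adjoint (yen T US Q A))
    ∧ (∀ A B : HS →L[ℂ] HS, yen T US Q (A * B) = yen T US Q A * yen T US Q B) := by
  refine ⟨?_, fun A => ?_, fun A B => ?_⟩
  · simp only [yen, mul_one, (hUSuni _).2]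
    exact T.sum_tmap_one _ Q hQsum
  · simp only [yen, map_sum, T.adjoint_tmap, hQsa]
    simp only [← star_eq_adjoint, star_mul, star_star, mul_assoc]
  · have conj_mul (g : G) : US g * (A * B) * adjoint (US g) =
        US g * A * adjoint (US g) * (US g * B * adjoint (US g)) := by
      calc _ = US g * A * 1 * (B * adjoint (US g)) := by simp only [mul_one, mul_assoc]
        _ = _ := by rw [← (hUSuni g).1]; simp only [mul_assoc]
    simp only [yen, Finset.sum_mul_sum, T.tmap_mul_tmap]
    refine Finset.sum_congr rfl fun g _ => ?_
    rw [Finset.sum_eq_single g, hQidem, conj_mul]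
    · intro h _ hne
      rw [hQorth g h hne.symm, T.tmap_zero_right]
    · simp

end
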